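/- Let a b : ℝ be computable reals with a < b. Let U V : ℕ → ℚ × ℚ be computable functions and define the computably enumerable open sets A := ⋃ n, Ioo ((U n).1 : ℝ) ((U n).2 : ℝ) and B := ⋃ n, Ioo ((V n).1 : ℝ) ((V n).2 : ℝ). Suppose: (1) every computable real x ∈ Icc a b lies in A ∪ B; (2) no computable real x ∈ Icc a b lies in both A and B; (3) there exists a computable real in Icc a b ∩ A; (4) there exists a computable real in Icc a b ∩ B. Then False. -/

import Mathlib

/-- A real number is computable if some computable sequence of rationals
approximates it with error at most `(1/2)^n`. -/
def IsComputableReal (x : ℝ) : Prop :=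
  ∃ f : ℕ → ℚ, Computable f ∧ ∀ n : ℕ, |x - (f n : ℝ)| ≤ (1 / 2 : ℝ) ^ n

open Encodable Denumerable

protected theorem ComputablePred.and {α : Type*} [Primcodable α] {p q : α → Prop}
    (hp : ComputablePred p) (hq : ComputablePred q) : ComputablePred fun a => p a ∧ q a := by
  classical
  refine Computable.computablePred ?_
  exact (Primrec.and.to_comp.comp hp.decide hq.decide).of_eq fun a => by simp

protected theorem ComputablePred.comp {α β : Type*} [Primcodable α] [Primcodable β]
    {p : β → Prop} (hp : ComputablePred p) {f : α → β} (hf : Computable f) :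
    ComputablePred fun a => p (f a) := by
  classical
  exact Computable.computablePred (hp.decide.comp hf)

protected theorem ComputablePred.or {α : Type*} [Primcodable α] {p q : α → Prop}
    (hp : ComputablePred p) (hq : ComputablePred q) : ComputablePred fun a => p a ∨ q a :=
  (hp.not.and hq.not).not.of_eq fun a => by tauto

protected theorem Computable.ite {α σ : Type*} [Primcodable α] [Primcodable σ] {c : α → Prop}
    [DecidablePred c] (hc : ComputablePred c) {f g : α → σ} (hf : Computable f)
    (hg : Computable g) : Computable fun a => if c a then f a else g a := by
  simpa [Bool.cond_decide] using hc.decide.cond hf hg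

protected theorem Computable.iterate {σ : Type*} [Primcodable σ] {f : σ → σ} (hf : Computable f)
    (s : σ) : Computable fun n => f^[n] s := by
  have hrec : Computable fun n : ℕ => (n.rec s fun _ t => f t : σ) :=
    Computable.nat_rec Computable.id (Computable.const s)
      (hf.comp (Computable.snd.comp Computable.snd)).to₂
  refine hrec.of_eq fun n => ?_
  induction n with
  | zero => rfl
  | succ n ih => rw [Function.iterate_succ_apply', ← ih]

theorem Computable.nat_add {α : Type*} [Primcodable α] {f g : α → ℕ}
    (hf : Computable f) (hg : Computable g) : Computable fun a => f a + g a :=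
  Primrec.nat_add.to_comp.comp hf hg

theorem Computable.nat_mul {α : Type*} [Primcodable α] {f g : α → ℕ}
    (hf : Computable f) (hg : Computable g) : Computable fun a => f a * g a :=
  Primrec.nat_mul.to_comp.comp hf hg

/-- The strictly increasing enumeration of an infinite decidable set of naturals is computable. -/
theorem Nat.Subtype.computable_ofNat (s : Set ℕ) [DecidablePred (· ∈ s)] [Infinite s]
    (hs : ComputablePred (· ∈ s)) : Computable fun n => (Nat.Subtype.ofNat s n : ℕ) := by
  have hlarge (x : ℕ) : ∃ m, x < m ∧ m ∈ s := by
    obtain ⟨m, hm, hx⟩ := (Set.infinite_coe_iff.mp ‹Infinite s›).exists_gt x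
    exact ⟨m, hx, hm⟩
  have hfind : Computable fun x => Nat.find (hlarge x) :=
    Computable.find (P := fun x m => x < m ∧ m ∈ s)
      (Primrec.nat_lt.computablePred.and (hs.comp Computable.snd)) hlarge
  refine (hfind.iterate (Nat.Subtype.ofNat s 0 : ℕ)).of_eq fun n => ?_
  induction n with
  | zero => rfl
  | succ n ih =>
    rw [Function.iterate_succ_apply', ih, Nat.find_eq_iff]
    refine ⟨⟨Nat.Subtype.lt_succ_self _, (Nat.Subtype.succ _).2⟩, fun m hm h => ?_⟩
    exact (Nat.Subtype.succ_le_of_lt (x := ⟨m, h.2⟩) h.1).not_gt hm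

namespace Rat

/-- The code of a rational as the pair of its numerator and denominator. -/
abbrev pairCode (q : ℚ) : ℕ := Nat.pair (Equiv.intEquivNat q.num) q.den

theorem natAbs_intEquivNat_symm (c : ℕ) : (Equiv.intEquivNat.symm c).natAbs = (c + 1) / 2 := by
  obtain ⟨x, rfl⟩ := Equiv.intEquivNat.surjective c
  rw [Equiv.symm_apply_apply]
  cases x with
  | ofNat n => change n = (2 * n + 1) / 2; lia
  | negSucc n => change n + 1 = (2 * n + 1 + 1) / 2; lia

theorem toNat_eq_intEquivNat (x : ℤ) :
    x.toNat = if Equiv.intEquivNat x % 2 = 0 then Equiv.intEquivNat x / 2 else 0 := by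
  cases x with
  | ofNat n => change n = if (2 * n) % 2 = 0 then (2 * n) / 2 else 0; simp
  | negSucc n =>
    change 0 = if (2 * n + 1) % 2 = 0 then (2 * n + 1) / 2 else 0
    simp [Nat.add_mod]

theorem toNat_neg_eq_intEquivNat (x : ℤ) :
    (-x).toNat = if Equiv.intEquivNat x % 2 = 0 then 0 else Equiv.intEquivNat x / 2 + 1 := by
  cases x with
  | ofNat n =>
    change (-(n : ℤ)).toNat = if (2 * n) % 2 = 0 then 0 else (2 * n) / 2 + 1
    simp
  | negSucc n =>
    change n + 1 = if (2 * n + 1) % 2 = 0 then 0 else (2 * n + 1) / 2 + 1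
    rw [if_neg (by lia)]
    lia

theorem mem_range_pairCode (m : ℕ) : m ∈ Set.range pairCode ↔
    0 < m.unpair.2 ∧ ∀ k < m.unpair.2 + 1,
      ((m.unpair.1 + 1) / 2 % k = 0 ∧ m.unpair.2 % k = 0) → k = 1 := by
  constructor
  · rintro ⟨q, rfl⟩
    simp only [pairCode, Nat.unpair_pair, ← natAbs_intEquivNat_symm, Equiv.symm_apply_apply]
    exact ⟨q.den_pos, fun k _ hk => Nat.eq_one_of_dvd_coprimes q.reduced
      (Nat.dvd_of_mod_eq_zero hk.1) (Nat.dvd_of_mod_eq_zero hk.2)⟩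
  · rintro ⟨hpos, h⟩
    rw [← natAbs_intEquivNat_symm] at h
    have hd := Nat.gcd_dvd_right (Equiv.intEquivNat.symm m.unpair.1).natAbs m.unpair.2
    have hn := Nat.gcd_dvd_left (Equiv.intEquivNat.symm m.unpair.1).natAbs m.unpair.2
    refine ⟨⟨Equiv.intEquivNat.symm m.unpair.1, m.unpair.2, hpos.ne', ?_⟩, by simp [pairCode]⟩
    exact h _ (Nat.lt_succ_of_le (Nat.le_of_dvd hpos hd))
      ⟨Nat.mod_eq_zero_of_dvd hn, Nat.mod_eq_zero_of_dvd hd⟩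

theorem primrecPred_mem_range_pairCode : PrimrecPred (· ∈ Set.range pairCode) := by
  have hsnd : Primrec fun m : ℕ => m.unpair.2 := Primrec.snd.comp Primrec.unpair
  have hfst : Primrec fun m : ℕ => (m.unpair.1 + 1) / 2 :=
    Primrec.nat_div.comp (Primrec.succ.comp (Primrec.fst.comp Primrec.unpair)) (Primrec.const 2)
  have hdvd : PrimrecRel fun k m : ℕ =>
      ((m.unpair.1 + 1) / 2 % k = 0 ∧ m.unpair.2 % k = 0) → k = 1 := by
    have h₁ : PrimrecPred fun p : ℕ × ℕ => (p.2.unpair.1 + 1) / 2 % p.1 = 0 :=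
      Primrec.eq.comp (Primrec.nat_mod.comp (hfst.comp Primrec.snd) Primrec.fst)
        (Primrec.const 0)
    have h₂ : PrimrecPred fun p : ℕ × ℕ => p.2.unpair.2 % p.1 = 0 :=
      Primrec.eq.comp (Primrec.nat_mod.comp (hsnd.comp Primrec.snd) Primrec.fst)
        (Primrec.const 0)
    have h₃ : PrimrecPred fun p : ℕ × ℕ => p.1 = 1 :=
      Primrec.eq.comp Primrec.fst (Primrec.const 1)
    exact (((h₁.and h₂).not).or h₃).of_eq fun p => by tauto
  have hpos : PrimrecPred fun m : ℕ => 0 < m.unpair.2 :=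
    Primrec.nat_lt.comp (Primrec.const 0) hsnd
  exact (hpos.and (hdvd.forall_lt.comp (Primrec.succ.comp hsnd) Primrec.id)).of_eq
    fun m => (mem_range_pairCode m).symm

theorem computable_pairCode : Computable pairCode := by
  let _ := @decidableRangeEncode ℚ Rat.instEncodable
  have : Infinite (Set.range (@encode ℚ Rat.instEncodable)) :=
    Infinite.of_injective _ (Equiv.ofInjective _ (@encode_injective ℚ Rat.instEncodable)).injective
  have hcode (n : ℕ) : pairCode (Denumerable.ofNat ℚ n) =
      (Nat.Subtype.ofNat (Set.range (@encode ℚ Rat.instEncodable)) n : ℕ) := by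
    simp only [Denumerable.ofNat]
    rw [Option.get_of_eq_some]
    rotate_left
    · rfl
    · exact congrArg Subtype.val ((@equivRangeEncode ℚ Rat.instEncodable).apply_symm_apply _)
  have h : Computable fun n => pairCode (Denumerable.ofNat ℚ n) :=
    (Nat.Subtype.computable_ofNat (Set.range (@encode ℚ Rat.instEncodable))
      primrecPred_mem_range_pairCode.computablePred).of_eq
      fun n => (hcode n).symm
  exact (h.comp Computable.encode).of_eq fun q => by rw [Denumerable.ofNat_encode]

theorem computable_den : Computable Rat.den :=
  ((Primrec.snd.comp Primrec.unpair).to_comp.comp computable_pairCode).of_eq fun q => by simp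

theorem computable_toNat_num : Computable fun q : ℚ => q.num.toNat := by
  have h : Primrec fun c : ℕ => if c % 2 = 0 then c / 2 else 0 :=
    Primrec.ite (Primrec.eq.comp (Primrec.nat_mod.comp Primrec.id (Primrec.const 2))
      (Primrec.const 0)) (Primrec.nat_div.comp Primrec.id (Primrec.const 2)) (Primrec.const 0)
  refine ((h.comp (Primrec.fst.comp Primrec.unpair)).to_comp.comp computable_pairCode).of_eq
    fun q => ?_
  rw [toNat_eq_intEquivNat, Nat.unpair_pair]

theorem computable_toNat_neg_num : Computable fun q : ℚ => (-q.num).toNat := by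
  have h : Primrec fun c : ℕ => if c % 2 = 0 then 0 else c / 2 + 1 :=
    Primrec.ite (Primrec.eq.comp (Primrec.nat_mod.comp Primrec.id (Primrec.const 2))
      (Primrec.const 0)) (Primrec.const 0)
      (Primrec.succ.comp (Primrec.nat_div.comp Primrec.id (Primrec.const 2)))
  refine ((h.comp (Primrec.fst.comp Primrec.unpair)).to_comp.comp computable_pairCode).of_eq
    fun q => ?_
  rw [toNat_neg_eq_intEquivNat, Nat.unpair_pair]

theorem eq_toNat_sub_toNat_div_den (q : ℚ) :
    q = ((q.num.toNat : ℚ) - ((-q.num).toNat : ℚ)) / q.den := by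
  have h : ((q.num.toNat : ℤ) : ℚ) - (((-q.num).toNat : ℤ) : ℚ) = q.num := by
    rw [← Int.cast_sub, Int.toNat_sub_toNat_neg]
  rw [Int.cast_natCast, Int.cast_natCast] at h
  rw [h, Rat.num_div_den]

theorem computablePred_lt {α : Type*} [Primcodable α] {f g : α → ℚ}
    (hf : Computable f) (hg : Computable g) : ComputablePred fun a => f a < g a := by
  have hl := ((computable_toNat_num.comp hf).nat_mul (computable_den.comp hg)).nat_add
    ((computable_toNat_neg_num.comp hg).nat_mul (computable_den.comp hf))
  have hr := ((computable_toNat_num.comp hg).nat_mul (computable_den.comp hf)).nat_add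
    ((computable_toNat_neg_num.comp hf).nat_mul (computable_den.comp hg))
  refine ((PrimrecPred.computablePred (p := fun y : ℕ × ℕ => y.1 < y.2) Primrec.nat_lt).comp
    (hl.pair hr)).of_eq fun a => ?_
  have hx : (0 : ℚ) < (f a).den := by exact_mod_cast (f a).den_pos
  have hy : (0 : ℚ) < (g a).den := by exact_mod_cast (g a).den_pos
  conv_rhs => rw [eq_toNat_sub_toNat_div_den (f a), eq_toNat_sub_toNat_div_den (g a),
    div_lt_div_iff₀ hx hy]
  rw [← @Nat.cast_lt ℚ]
  push_cast
  constructor <;> intro h <;> linarith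

/-- The midpoint of two rationals is computable: search for it using integer arithmetic. -/
theorem computable_midpoint : Computable fun p : ℚ × ℚ => (p.1 + p.2) / 2 := by
  have hmid : ComputablePred fun x : (ℚ × ℚ) × ℕ =>
      Denumerable.ofNat ℚ x.2 = (x.1.1 + x.1.2) / 2 := by
    have hz := (Computable.ofNat ℚ).comp (Computable.snd (α := ℚ × ℚ) (β := ℕ))
    have hr := (Computable.fst (α := ℚ) (β := ℚ)).comp (Computable.fst (α := ℚ × ℚ) (β := ℕ))
    have hs := (Computable.snd (α := ℚ) (β := ℚ)).comp (Computable.fst (α := ℚ × ℚ) (β := ℕ))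
    have hrd := computable_den.comp hr
    have hsd := computable_den.comp hs
    have hzd := computable_den.comp hz
    have hd := (Computable.const (α := (ℚ × ℚ) × ℕ) 2).nat_mul (hrd.nat_mul hsd)
    have hleft := (hd.nat_mul (computable_toNat_num.comp hz)).nat_add
      ((((computable_toNat_neg_num.comp hr).nat_mul hsd).nat_add
        ((computable_toNat_neg_num.comp hs).nat_mul hrd)).nat_mul hzd)
    have hright := (hd.nat_mul (computable_toNat_neg_num.comp hz)).nat_add
      ((((computable_toNat_num.comp hr).nat_mul hsd).nat_add
        ((computable_toNat_num.comp hs).nat_mul hrd)).nat_mul hzd)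
    refine ((PrimrecPred.computablePred (p := fun y : ℕ × ℕ => y.1 = y.2) Primrec.eq).comp
      (hleft.pair hright)).of_eq fun x => ?_
    obtain ⟨⟨r, s⟩, n⟩ := x
    generalize hz : Denumerable.ofNat ℚ n = z
    dsimp only
    have hr : (r.den : ℚ) ≠ 0 := by exact_mod_cast r.den_nz
    have hs : (s.den : ℚ) ≠ 0 := by exact_mod_cast s.den_nz
    have hz : (z.den : ℚ) ≠ 0 := by exact_mod_cast z.den_nz
    conv_rhs => rw [eq_toNat_sub_toNat_div_den r, eq_toNat_sub_toNat_div_den s,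
      eq_toNat_sub_toNat_div_den z, div_add_div _ _ hr hs, div_div,
      div_eq_div_iff hz (mul_ne_zero (mul_ne_zero hr hs) two_ne_zero)]
    rw [← @Nat.cast_inj ℚ]
    push_cast
    constructor <;> intro h <;> linarith
  have hex (p : ℚ × ℚ) : ∃ n, Denumerable.ofNat ℚ n = (p.1 + p.2) / 2 :=
    ⟨_, Denumerable.ofNat_encode _⟩
  exact ((Computable.ofNat ℚ).comp
    (Computable.find (P := fun (p : ℚ × ℚ) n => Denumerable.ofNat ℚ n = (p.1 + p.2) / 2)
      hmid hex)).of_eq fun p => Nat.find_spec (hex p)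

end Rat

theorem isComputableReal_ratCast (q : ℚ) : IsComputableReal q :=
  ⟨fun _ => q, Computable.const q, fun n => by simp⟩

/-- Membership of rationals in one of two computably enumerable open sets covering `[p, q]` can be
decided, in the sense that some computable predicate selects a set containing the given point. -/
theorem exists_computablePred_of_cover {U V : ℕ → ℚ × ℚ} (hU : Computable U) (hV : Computable V)
    {A B : Set ℝ} (hA : A = ⋃ n, Set.Ioo ((U n).1 : ℝ) ((U n).2 : ℝ))
    (hB : B = ⋃ n, Set.Ioo ((V n).1 : ℝ) ((V n).2 : ℝ)) {p q : ℚ}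
    (hcover : ∀ x : ℚ, p ≤ x → x ≤ q → (x : ℝ) ∈ A ∪ B) :
    ∃ c : ℚ → Prop, ComputablePred c ∧ ∀ x : ℚ, p ≤ x → x ≤ q →
      (c x → (x : ℝ) ∈ B) ∧ (¬ c x → (x : ℝ) ∈ A) := by
  have hmem {W : ℕ → ℚ × ℚ} (hW : Computable W) :
      ComputablePred fun y : ℚ × ℕ => (W y.2).1 < y.1 ∧ y.1 < (W y.2).2 :=
    (Rat.computablePred_lt (Computable.fst.comp (hW.comp Computable.snd)) Computable.fst).and
      (Rat.computablePred_lt Computable.fst (Computable.snd.comp (hW.comp Computable.snd)))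
  have hout : ComputablePred fun y : ℚ × ℕ => y.1 < p ∨ q < y.1 :=
    (Rat.computablePred_lt Computable.fst (Computable.const p)).or
      (Rat.computablePred_lt (Computable.const q) Computable.fst)
  have hex (x : ℚ) : ∃ n, (((U n).1 < x ∧ x < (U n).2) ∨ ((V n).1 < x ∧ x < (V n).2)) ∨
      (x < p ∨ q < x) := by
    by_cases hx : p ≤ x ∧ x ≤ q
    · rcases hcover x hx.1 hx.2 with h | h
      · obtain ⟨n, hn⟩ := Set.mem_iUnion.mp (hA ▸ h)
        exact ⟨n, .inl (.inl ⟨Rat.cast_lt.mp hn.1, Rat.cast_lt.mp hn.2⟩)⟩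
      · obtain ⟨n, hn⟩ := Set.mem_iUnion.mp (hB ▸ h)
        exact ⟨n, .inl (.inr ⟨Rat.cast_lt.mp hn.1, Rat.cast_lt.mp hn.2⟩)⟩
    · exact ⟨0, .inr (by rw [← not_le, ← not_le]; tauto)⟩
  have hfind := Computable.find (P := fun (x : ℚ) n =>
    (((U n).1 < x ∧ x < (U n).2) ∨ ((V n).1 < x ∧ x < (V n).2)) ∨ (x < p ∨ q < x))
    (((hmem hU).or (hmem hV)).or hout) hex
  refine ⟨_, (hmem hV).comp (Computable.id.pair hfind), fun x hpx hxq => ⟨fun h => ?_, fun h => ?_⟩⟩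
  · rw [hB]
    exact Set.mem_iUnion.mpr ⟨_, Rat.cast_lt.mpr h.1, Rat.cast_lt.mpr h.2⟩
  · rw [hA]
    rcases Nat.find_spec (hex x) with (h' | h') | h' | h'
    · exact Set.mem_iUnion.mpr ⟨_, Rat.cast_lt.mpr h'.1, Rat.cast_lt.mpr h'.2⟩
    · exact absurd h' h
    · exact absurd h' hpx.not_gt
    · exact absurd h' hxq.not_gt

/-- Bisection along a computable predicate converges to a computable real. -/
theorem exists_isComputableReal_of_bisection {c : ℚ → Prop} (hc : ComputablePred c) {p q : ℚ}
    (hpq : p ≤ q) :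
    ∃ (x : ℝ) (l r : ℕ → ℚ), IsComputableReal x ∧ l 0 = p ∧ r 0 = q ∧
      (∀ n, (p : ℝ) ≤ l n ∧ (l n : ℝ) ≤ x ∧ x ≤ r n ∧ (r n : ℝ) ≤ q) ∧
      (∀ n, (l (n + 1) = l n ∨ ¬ c (l (n + 1))) ∧ (r (n + 1) = r n ∨ c (r (n + 1)))) ∧
      Filter.Tendsto (fun n => (l n : ℝ)) Filter.atTop (nhds x) ∧
      Filter.Tendsto (fun n => (r n : ℝ)) Filter.atTop (nhds x) := by
  classical
  let step (s : ℚ × ℚ) : ℚ × ℚ :=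
    if c ((s.1 + s.2) / 2) then (s.1, (s.1 + s.2) / 2) else ((s.1 + s.2) / 2, s.2)
  have hstep : Computable step :=
    Computable.ite (hc.comp Rat.computable_midpoint)
      (Computable.fst.pair Rat.computable_midpoint) (Rat.computable_midpoint.pair Computable.snd)
  let F (n : ℕ) : ℚ × ℚ := step^[n] (p, q)
  have hF : Computable F := hstep.iterate (p, q)
  have hsucc (n : ℕ) : F (n + 1) = step (F n) := Function.iterate_succ_apply' step n (p, q)
  have hlength (n : ℕ) : (F n).2 - (F n).1 = (q - p) / 2 ^ n := by
    induction n with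
    | zero => simp [F]
    | succ n ih =>
      rw [hsucc, pow_succ, ← div_div, ← ih]
      dsimp only [step]
      split_ifs <;> dsimp only <;> ring
  have hle (n : ℕ) : (F n).1 ≤ (F n).2 := by
    rw [← sub_nonneg, hlength]
    exact div_nonneg (sub_nonneg.mpr hpq) (by positivity)
  have hmono : Monotone fun n => ((F n).1 : ℝ) := monotone_nat_of_le_succ fun n => by
    rw [hsucc]
    dsimp only [step]
    have := hle n
    split_ifs
    · rfl
    · exact_mod_cast (by linarith : (F n).1 ≤ ((F n).1 + (F n).2) / 2)
  have hanti : Antitone fun n => ((F n).2 : ℝ) := antitone_nat_of_succ_le fun n => by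
    rw [hsucc]
    dsimp only [step]
    have := hle n
    split_ifs
    · exact_mod_cast (by linarith : ((F n).1 + (F n).2) / 2 ≤ (F n).2)
    · rfl
  have hlr (m n : ℕ) : ((F m).1 : ℝ) ≤ (F n).2 :=
    (hmono (le_max_left m n)).trans <|
      (by exact_mod_cast hle (max m n) : ((F (max m n)).1 : ℝ) ≤ (F (max m n)).2).trans
        (hanti (le_max_right m n))
  let x : ℝ := ⨆ n, ((F n).1 : ℝ)
  have hl (n : ℕ) : ((F n).1 : ℝ) ≤ x :=
    le_ciSup ⟨((F 0).2 : ℝ), by rintro _ ⟨m, rfl⟩; exact hlr m 0⟩ n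
  have hr (n : ℕ) : x ≤ (F n).2 := ciSup_le fun m => hlr m n
  have hlengthReal (n : ℕ) : ((F n).2 : ℝ) - (F n).1 = (q - p) * (1 / 2) ^ n := by
    rw [one_div, inv_pow, ← div_eq_mul_inv]
    exact_mod_cast hlength n
  have hlim : Filter.Tendsto (fun n => ((q : ℝ) - p) * (1 / 2) ^ n) Filter.atTop (nhds 0) := by
    simpa using (tendsto_pow_atTop_nhds_zero_of_lt_one (r := (1 / 2 : ℝ)) (by norm_num)
      (by norm_num)).const_mul ((q : ℝ) - p)
  refine ⟨x, fun n => (F n).1, fun n => (F n).2, ?_, rfl, rfl,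
    fun n => ⟨hmono (Nat.zero_le n), hl n, hr n, hanti (Nat.zero_le n)⟩, fun n => ?_, ?_, ?_⟩
  · obtain ⟨N, hN⟩ := pow_unbounded_of_one_lt ((q : ℝ) - p) (one_lt_two)
    refine ⟨fun n => (F (n + N)).1, Computable.fst.comp
      (hF.comp (Computable.id.nat_add (Computable.const N))), fun n => ?_⟩
    rw [abs_of_nonneg (sub_nonneg.mpr (hl _))]
    calc x - (F (n + N)).1 ≤ (F (n + N)).2 - (F (n + N)).1 := by gcongr; exact hr _
      _ = (q - p) * (1 / 2) ^ (n + N) := hlengthReal _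
      _ ≤ 2 ^ N * (1 / 2) ^ (n + N) := by gcongr
      _ = (1 / 2) ^ n := by
        rw [pow_add, mul_left_comm, ← mul_pow]
        norm_num
  · simp only [hsucc]
    dsimp only [step]
    split_ifs with h
    · exact ⟨.inl rfl, .inr h⟩
    · exact ⟨.inr h, .inl rfl⟩
  · refine tendsto_of_tendsto_of_tendsto_of_le_of_le
      (by simpa only [sub_zero] using (tendsto_const_nhds (x := x)).sub hlim)
      tendsto_const_nhds ?_ hl
    intro n
    have := hlengthReal n
    have := hr n
    dsimp only
    linarith
  · refine tendsto_of_tendsto_of_tendsto_of_le_of_le tendsto_const_nhds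
      (by simpa only [add_zero] using (tendsto_const_nhds (x := x)).add hlim) hr ?_
    intro n
    have := hlengthReal n
    have := hl n
    dsimp only
    linarith

theorem false_of_rational_separation {U V : ℕ → ℚ × ℚ} (hU : Computable U) (hV : Computable V)
    {A B : Set ℝ} (hA : A = ⋃ n, Set.Ioo ((U n).1 : ℝ) ((U n).2 : ℝ))
    (hB : B = ⋃ n, Set.Ioo ((V n).1 : ℝ) ((V n).2 : ℝ)) {p q : ℚ} (hpq : p ≤ q)
    (hp : (p : ℝ) ∈ A) (hq : (q : ℝ) ∈ B)
    (hcover : ∀ x : ℝ, IsComputableReal x → x ∈ Set.Icc (p : ℝ) q → x ∈ A ∪ B)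
    (hdisj : ∀ x : ℝ, IsComputableReal x → x ∈ Set.Icc (p : ℝ) q → ¬(x ∈ A ∧ x ∈ B)) :
    False := by
  have hAo : IsOpen A := hA ▸ isOpen_iUnion fun n => isOpen_Ioo
  have hBo : IsOpen B := hB ▸ isOpen_iUnion fun n => isOpen_Ioo
  obtain ⟨c, hc, hcAB⟩ := exists_computablePred_of_cover hU hV hA hB (p := p) (q := q) fun x hpx hxq =>
    hcover x (isComputableReal_ratCast x) ⟨by exact_mod_cast hpx, by exact_mod_cast hxq⟩
  obtain ⟨x, l, r, hx, hl0, hr0, hbound, hstep, hl, hr⟩ :=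
    exists_isComputableReal_of_bisection hc hpq
  have hlmem (n : ℕ) : (l n : ℝ) ∈ Set.Icc (p : ℝ) q :=
    ⟨(hbound n).1, ((hbound n).2.1.trans (hbound n).2.2.1).trans (hbound n).2.2.2⟩
  have hrmem (n : ℕ) : (r n : ℝ) ∈ Set.Icc (p : ℝ) q :=
    ⟨((hbound n).1.trans (hbound n).2.1).trans (hbound n).2.2.1, (hbound n).2.2.2⟩
  have hlA (n : ℕ) : (l n : ℝ) ∈ A := by
    induction n with
    | zero => rwa [hl0]
    | succ n ih =>
      rcases (hstep n).1 with h | h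
      · rwa [h]
      · exact (hcAB _ (by exact_mod_cast (hlmem (n + 1)).1)
          (by exact_mod_cast (hlmem (n + 1)).2)).2 h
  have hrB (n : ℕ) : (r n : ℝ) ∈ B := by
    induction n with
    | zero => rwa [hr0]
    | succ n ih =>
      rcases (hstep n).2 with h | h
      · rwa [h]
      · exact (hcAB _ (by exact_mod_cast (hrmem (n + 1)).1)
          (by exact_mod_cast (hrmem (n + 1)).2)).1 h
  have hxmem : x ∈ Set.Icc (p : ℝ) q :=
    ⟨(hbound 0).1.trans (hbound 0).2.1, (hbound 0).2.2.1.trans (hbound 0).2.2.2⟩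
  rcases hcover x hx hxmem with h | h
  · obtain ⟨n, hn⟩ := (hr.eventually (hAo.mem_nhds h)).exists
    exact hdisj _ (isComputableReal_ratCast _) (hrmem n) ⟨hn, hrB n⟩
  · obtain ⟨n, hn⟩ := (hl.eventually (hBo.mem_nhds h)).exists
    exact hdisj _ (isComputableReal_ratCast _) (hlmem n) ⟨hlA n, hn⟩

theorem exists_rat_mem_Icc_inter_of_isOpen {a b x : ℝ} (hab : a < b) {S : Set ℝ} (hS : IsOpen S)
    (hx : x ∈ Set.Icc a b ∩ S) : ∃ p : ℚ, (p : ℝ) ∈ Set.Icc a b ∩ S := by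
  have hcl : x ∈ closure (Set.Ioo a b) := by rw [closure_Ioo hab.ne]; exact hx.1
  obtain ⟨y, hy⟩ := mem_closure_iff.mp hcl S hS hx.2
  obtain ⟨p, hp⟩ := Rat.denseRange_cast.exists_mem_open (hS.inter isOpen_Ioo) ⟨y, hy⟩
  exact ⟨p, Set.Ioo_subset_Icc_self hp.2, hp.1⟩

theorem interval_of_computable_reals_connected
    (a b : ℝ) (ha : IsComputableReal a) (hb : IsComputableReal b) (hab : a < b)
    (U V : ℕ → ℚ × ℚ) (hU : Computable U) (hV : Computable V)
    (A : Set ℝ) (hA : A = ⋃ n, Set.Ioo ((U n).1 : ℝ) ((U n).2 : ℝ))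
    (B : Set ℝ) (hB : B = ⋃ n, Set.Ioo ((V n).1 : ℝ) ((V n).2 : ℝ))
    (hcover : ∀ x : ℝ, IsComputableReal x → x ∈ Set.Icc a b → x ∈ A ∪ B)
    (hdisj : ∀ x : ℝ, IsComputableReal x → x ∈ Set.Icc a b → ¬(x ∈ A ∧ x ∈ B))
    (hAne : ∃ x : ℝ, IsComputableReal x ∧ x ∈ Set.Icc a b ∩ A)
    (hBne : ∃ x : ℝ, IsComputableReal x ∧ x ∈ Set.Icc a b ∩ B) :
    False := by
  have hAo : IsOpen A := hA ▸ isOpen_iUnion fun n => isOpen_Ioo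
  have hBo : IsOpen B := hB ▸ isOpen_iUnion fun n => isOpen_Ioo
  obtain ⟨x, -, hx⟩ := hAne
  obtain ⟨y, -, hy⟩ := hBne
  obtain ⟨p, hp, hpA⟩ := exists_rat_mem_Icc_inter_of_isOpen hab hAo hx
  obtain ⟨q, hq, hqB⟩ := exists_rat_mem_Icc_inter_of_isOpen hab hBo hy
  rcases le_total p q with hpq | hqp
  · have hsub : Set.Icc (p : ℝ) q ⊆ Set.Icc a b := Set.Icc_subset_Icc hp.1 hq.2
    exact false_of_rational_separation hU hV hA hB hpq hpA hqB
      (fun z hz hzm => hcover z hz (hsub hzm)) fun z hz hzm => hdisj z hz (hsub hzm)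
  · have hsub : Set.Icc (q : ℝ) p ⊆ Set.Icc a b := Set.Icc_subset_Icc hq.1 hp.2
    exact false_of_rational_separation hV hU hB hA hqp hqB hpA
      (fun z hz hzm => (hcover z hz (hsub hzm)).symm)
      fun z hz hzm h => hdisj z hz (hsub hzm) h.symm
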